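/- Let G be a (theta, prism)-free graph, let W = (H, c) be a non-special wheel in G such that the hole H has length at least seven, let S = N_H(c) and let T = N[c] ∪ (N[S] \ V(H)). Suppose a vertex v ∈ V(G) \ (W ∪ T) has either a unique neighbor or two non-adjacent neighbors in some sector P = p-…-p' of W. Let b be the neighbor of p in H \ P and let b' be the neighbor of p' in H \ P. Then N_H(v) ⊆ V(P) ∪ {b, b'}. -/

import Mathlib

open SimpleGraph

namespace Paper

variable {V : Type}

/-- Two vertex sets are anticomplete: no edges between them. -/
def Anticomplete (G : SimpleGraph V) (A B : Set V) : Prop :=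
  ∀ a ∈ A, ∀ b ∈ B, ¬ G.Adj a b

/-- A stable (independent) set of vertices. -/
def StableSet (G : SimpleGraph V) (A : Set V) : Prop :=
  ∀ x ∈ A, ∀ y ∈ A, x ≠ y → ¬ G.Adj x y

/-- A walk is induced in `G`: any two adjacent vertices on it are consecutive. -/
def InducedWalk (G : SimpleGraph V) {u v : V} (P : G.Walk u v) : Prop :=
  ∀ x ∈ P.support, ∀ y ∈ P.support, G.Adj x y → s(x, y) ∈ P.edges

/-- The interior (set of internal vertices) of a walk from `u` to `v`. -/
def Interior {G : SimpleGraph V} {u v : V} (P : G.Walk u v) : Set V :=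
  {w | w ∈ P.support ∧ w ≠ u ∧ w ≠ v}

/-- Closed neighborhood of a set of vertices. -/
def ClosedNbhd (G : SimpleGraph V) (A : Set V) : Set V :=
  A ∪ {v | ∃ a ∈ A, G.Adj v a}

/-- Open neighborhood of a set of vertices. -/
def OpenNbhd (G : SimpleGraph V) (A : Set V) : Set V :=
  {v | v ∉ A ∧ ∃ a ∈ A, G.Adj v a}

/-- `M` separates `x` and `y` in `G`: there is a separation `(L, M, R)` with `x ∈ L`, `y ∈ R`. -/
def Separates (G : SimpleGraph V) (M : Set V) (x y : V) : Prop :=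
  ∃ L R : Set V,
    L ∪ M ∪ R = Set.univ ∧
    Disjoint L M ∧ Disjoint L R ∧ Disjoint M R ∧
    L.Nonempty ∧ R.Nonempty ∧ Anticomplete G L R ∧ x ∈ L ∧ y ∈ R

/-- `G` contains a theta as an induced subgraph. -/
def ContainsTheta (G : SimpleGraph V) : Prop :=
  ∃ (a b : V) (P₁ P₂ P₃ : G.Walk a b),
    a ≠ b ∧ ¬ G.Adj a b ∧
    P₁.IsPath ∧ P₂.IsPath ∧ P₃.IsPath ∧
    InducedWalk G P₁ ∧ InducedWalk G P₂ ∧ InducedWalk G P₃ ∧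
    2 ≤ P₁.length ∧ 2 ≤ P₂.length ∧ 2 ≤ P₃.length ∧
    Disjoint (Interior P₁) (Interior P₂) ∧
    Disjoint (Interior P₁) (Interior P₃) ∧
    Disjoint (Interior P₂) (Interior P₃) ∧
    Anticomplete G (Interior P₁) (Interior P₂) ∧
    Anticomplete G (Interior P₁) (Interior P₃) ∧
    Anticomplete G (Interior P₂) (Interior P₃)

/-- `G` contains a prism as an induced subgraph (one path may have length zero). -/
def ContainsPrism (G : SimpleGraph V) : Prop :=
  ∃ (a b : Fin 3 → V) (P : ∀ i, G.Walk (a i) (b i)),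
    (∀ i j, i ≠ j → G.Adj (a i) (a j)) ∧
    (∀ i j, i ≠ j → G.Adj (b i) (b j)) ∧
    (∀ i, (P i).IsPath) ∧ (∀ i, InducedWalk G (P i)) ∧
    (∀ i j, i ≠ j → ∀ x, x ∈ (P i).support → x ∉ (P j).support) ∧
    (∀ i j, i ≠ j → ∀ x ∈ (P i).support, ∀ y ∈ (P j).support,
        G.Adj x y → (x = a i ∧ y = a j) ∨ (x = b i ∧ y = b j)) ∧
    (∀ i j, i ≠ j → 2 ≤ (P i).length + (P j).length)

/-- `G` contains `K_{1,t}` as an induced subgraph. -/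
def ContainsK1t (G : SimpleGraph V) (t : ℕ) : Prop :=
  ∃ (v : V) (S : Finset V),
    S.card = t ∧ v ∉ S ∧ (∀ x ∈ S, G.Adj v x) ∧ StableSet G ↑S

/-- `G` belongs to the class `C_t` of (theta, prism, `K_{1,t}`)-free graphs. -/
def MemCt (t : ℕ) (G : SimpleGraph V) : Prop :=
  ¬ ContainsTheta G ∧ ¬ ContainsPrism G ∧ ¬ ContainsK1t G t

/-- A tree decomposition of `G`. -/
structure TreeDecomp (G : SimpleGraph V) where
  ι : Type
  T : SimpleGraph ι
  isTree : T.IsTree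
  bag : ι → Set V
  mem_bag : ∀ v : V, ∃ i, v ∈ bag i
  edge_bag : ∀ u v : V, G.Adj u v → ∃ i, u ∈ bag i ∧ v ∈ bag i
  bag_connected : ∀ v : V, (T.induce {i | v ∈ bag i}).Connected

/-- The tree independence number of `G` is at most `k`. -/
def TreeAlphaLE (G : SimpleGraph V) (k : ℕ) : Prop :=
  ∃ D : TreeDecomp G, ∀ i : D.ι, ∀ S : Finset V,
    ↑S ⊆ D.bag i → StableSet G ↑S → S.card ≤ k

/-- Sum of weights over a vertex set. -/
noncomputable def wSum [Fintype V] (w : V → ℝ) (A : Set V) : ℝ :=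
  ∑ v, A.indicator w v

/-- `D` is a connected component of `G \ X`. -/
def IsComponentOf (G : SimpleGraph V) (X D : Set V) : Prop :=
  D.Nonempty ∧ D ⊆ Xᶜ ∧ (G.induce D).Connected ∧
  ∀ D' : Set V, D ⊆ D' → D' ⊆ Xᶜ → (G.induce D').Connected → D' = D

/-- `X` is a `w`-balanced separator in `G`. -/
def BalancedSeparator [Fintype V] (G : SimpleGraph V) (w : V → ℝ) (X : Set V) : Prop :=
  ∀ D : Set V, IsComponentOf G X D → wSum w D ≤ 1 / 2

/-- A closed walk is a hole (induced cycle of length at least four) in `G`. -/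
def IsHoleWalk (G : SimpleGraph V) {h : V} (H : G.Walk h h) : Prop :=
  H.IsCycle ∧ 4 ≤ H.length ∧ InducedWalk G H

/-- The neighbors of `c` on the hole `H`. -/
def HoleNbrs (G : SimpleGraph V) {h : V} (H : G.Walk h h) (c : V) : Set V :=
  {v | v ∈ H.support ∧ G.Adj c v}

/-- `(H, c)` is a wheel in `G`. -/
def IsWheel (G : SimpleGraph V) {h : V} (H : G.Walk h h) (c : V) : Prop :=
  IsHoleWalk G H ∧ c ∉ H.support ∧ 3 ≤ (HoleNbrs G H c).ncard

/-- `P` is a sector of the wheel `(H, c)`. -/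
def IsSector (G : SimpleGraph V) {h : V} (H : G.Walk h h) (c : V)
    {x y : V} (P : G.Walk x y) : Prop :=
  P.IsPath ∧ 0 < P.length ∧
  (∀ w ∈ P.support, w ∈ H.support) ∧
  (∀ e ∈ P.edges, e ∈ H.edges) ∧
  G.Adj c x ∧ G.Adj c y ∧
  ∀ w ∈ P.support, w ≠ x → w ≠ y → ¬ G.Adj c w

/-- The wheel `(H, c)` is special. -/
def IsSpecialWheel (G : SimpleGraph V) {h : V} (H : G.Walk h h) (c : V) : Prop :=
  IsWheel G H c ∧ ∃ a b d : V,
    a ≠ b ∧ a ≠ d ∧ b ≠ d ∧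
    HoleNbrs G H c = {a, b, d} ∧
    s(a, b) ∈ H.edges ∧ s(a, d) ∉ H.edges ∧ s(b, d) ∉ H.edges

/-- `Z(W)` for a non-special wheel `W = (H, c)`. -/
def ZNonSpecial (G : SimpleGraph V) {h : V} (H : G.Walk h h) (c : V) : Set V :=
  {c} ∪ HoleNbrs G H c

/-- `Z(W)` for a special wheel `W = (H, c)` with length-one sector `ab` and third neighbor `d`. -/
def ZSpecial (G : SimpleGraph V) {h : V} (H : G.Walk h h) (c a b d : V) : Set V :=
  ({a, b, c, d} : Set V) ∪ {v | s(v, d) ∈ H.edges}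

/-- A pyramid in `G` with apex `apx`, base `b 0, b 1, b 2` and paths `P i`. -/
def IsPyramid (G : SimpleGraph V) (apx : V) (b : Fin 3 → V)
    (P : ∀ i, G.Walk apx (b i)) : Prop :=
  (∀ i, b i ≠ apx) ∧
  (∀ i j, i ≠ j → G.Adj (b i) (b j)) ∧
  (∀ i, (P i).IsPath) ∧ (∀ i, InducedWalk G (P i)) ∧
  (∀ i, 1 ≤ (P i).length) ∧
  (∀ i j, i ≠ j → ∀ x, x ∈ (P i).support → x ∈ (P j).support → x = apx) ∧
  (∀ i j, i ≠ j → ∀ x ∈ (P i).support, ∀ y ∈ (P j).support,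
      x ≠ apx → y ≠ apx → G.Adj x y → x = b i ∧ y = b j) ∧
  (∀ i j, i ≠ j → 3 ≤ (P i).length + (P j).length)

/-- `Z(Σ)` for a pyramid. -/
def ZPyramid (G : SimpleGraph V) (apx : V) (b : Fin 3 → V)
    (P : ∀ i, G.Walk apx (b i)) : Set V :=
  {apx} ∪ {v | (∃ i, v ∈ (P i).support) ∧ G.Adj apx v} ∪ Set.range b

/-- `x : Fin k → V` enumerates `X` in an order witnessing that `(P, X)` is an alignment. -/
def AlignmentOrder (G : SimpleGraph V) {p q : V} (P : G.Walk p q)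
    (X : Finset V) {k : ℕ} (x : Fin k → V) : Prop :=
  Function.Injective x ∧ (∀ l, x l ∈ X) ∧ (∀ z ∈ X, ∃ l, x l = z) ∧
  ∃ lo hi : Fin k → ℕ,
    (∀ l, lo l ≤ hi l) ∧
    (∀ l m : Fin k, l < m → hi l < lo m) ∧
    (∀ l, hi l < P.support.length) ∧
    ∀ (l : Fin k) (n : Fin P.support.length),
      G.Adj (x l) (P.support.get n) → lo l ≤ (n : ℕ) ∧ (n : ℕ) ≤ hi l

/-- `(P, X)` is an alignment. -/
def IsAlignment (G : SimpleGraph V) {p q : V} (P : G.Walk p q) (X : Finset V) : Prop :=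
  (∀ z ∈ X, z ∉ P.support) ∧
  (∀ z ∈ X, ∃ u ∈ P.support, G.Adj z u) ∧
  ∃ (k : ℕ) (x : Fin k → V), AlignmentOrder G P X x

/-- Every vertex of `X` has two non-adjacent neighbors in `P`. -/
def WideAl (G : SimpleGraph V) {p q : V} (P : G.Walk p q) (X : Finset V) : Prop :=
  ∀ z ∈ X, ∃ u v : V, u ∈ P.support ∧ v ∈ P.support ∧
    G.Adj z u ∧ G.Adj z v ∧ u ≠ v ∧ ¬ G.Adj u v

/-- Every vertex of `X` has a unique neighbor in `P`. -/
def SpikyAl (G : SimpleGraph V) {p q : V} (P : G.Walk p q) (X : Finset V) : Prop :=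
  ∀ z ∈ X, ∃! u : V, u ∈ P.support ∧ G.Adj z u

/-- Every vertex of `X` has exactly two neighbors in `P`, and they are adjacent. -/
def TriangularAl (G : SimpleGraph V) {p q : V} (P : G.Walk p q) (X : Finset V) : Prop :=
  ∀ z ∈ X, ∃ u v : V, u ∈ P.support ∧ v ∈ P.support ∧
    G.Adj z u ∧ G.Adj z v ∧ u ≠ v ∧ G.Adj u v ∧
    ∀ w ∈ P.support, G.Adj z w → w = u ∨ w = v

/-- `(P, X)` is a consistent alignment. -/
def ConsistentAlignment (G : SimpleGraph V) {p q : V} (P : G.Walk p q) (X : Finset V) : Prop :=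
  IsAlignment G P X ∧ (WideAl G P X ∨ SpikyAl G P X ∨ TriangularAl G P X)

/-- A branch vertex of a graph: a vertex of degree at least three. -/
def BranchVtx {W : Type} (T : SimpleGraph W) (v : W) : Prop :=
  3 ≤ (T.neighborSet v).ncard

/-- `T` is a caterpillar: a tree of maximum degree three, no two branch vertices adjacent,
and some path contains all branch vertices. -/
def IsCaterpillar {W : Type} (T : SimpleGraph W) : Prop :=
  T.IsTree ∧ (∀ v, (T.neighborSet v).ncard ≤ 3) ∧
  (∀ u v, BranchVtx T u → BranchVtx T v → ¬ T.Adj u v) ∧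
  ∃ (x y : W) (P : T.Walk x y), P.IsPath ∧ ∀ v, BranchVtx T v → v ∈ P.support

/-- `T` is a subdivided star with root `r`. -/
def IsSubdividedStar {W : Type} (T : SimpleGraph W) (r : W) : Prop :=
  T.IsTree ∧ 3 ≤ (T.neighborSet r).ncard ∧ ∀ v, v ≠ r → (T.neighborSet v).ncard ≤ 2

/-- `H` is isomorphic to the line graph of a caterpillar. -/
def IsLineCaterpillar {U : Type} (H : SimpleGraph U) : Prop :=
  ∃ (W : Type) (T : SimpleGraph W), IsCaterpillar T ∧ Nonempty (H ≃g T.lineGraph)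

/-- `H` is isomorphic to the line graph of a subdivided star. -/
def IsLineSubdividedStar {U : Type} (H : SimpleGraph U) : Prop :=
  ∃ (W : Type) (T : SimpleGraph W) (r : W),
    IsSubdividedStar T r ∧ Nonempty (H ≃g T.lineGraph)

/-- `v` is a simplicial vertex of `G[S]`. -/
def SimplicialIn (G : SimpleGraph V) (S : Set V) (v : V) : Prop :=
  v ∈ S ∧ ∀ u ∈ S, ∀ w ∈ S, G.Adj v u → G.Adj v w → u ≠ w → G.Adj u w

/-- `G[S]` is one of the four connectifier shapes. -/
def ConnType (G : SimpleGraph V) (S : Set V) : Prop :=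
  IsCaterpillar (G.induce S) ∨ IsLineCaterpillar (G.induce S) ∨
  (∃ r, IsSubdividedStar (G.induce S) r) ∨ IsLineSubdividedStar (G.induce S)

/-- `(G[S], X)` is a connectifier. -/
def IsConnectifier (G : SimpleGraph V) (S : Set V) (X : Finset V) : Prop :=
  (∀ z ∈ X, (z : V) ∉ S) ∧ (∀ z ∈ X, ∃ r ∈ S, G.Adj z r) ∧
  ( (∃ v, S = {v}) ∨
    ( ConnType G S ∧
      (∀ z ∈ X, ∀ r₁ ∈ S, ∀ r₂ ∈ S, G.Adj z r₁ → G.Adj z r₂ → r₁ = r₂) ∧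
      (∀ z ∈ X, ∀ r ∈ S, G.Adj z r → SimplicialIn G S r) ∧
      (∀ v, SimplicialIn G S v → ∃ z ∈ X, G.Adj z v) ) )

/-- The connectifier `(G[S], X)` is concentrated. -/
def Concentrated (G : SimpleGraph V) (S : Set V) : Prop :=
  (∃ v, S = {v}) ∨ (∃ r, IsSubdividedStar (G.induce S) r) ∨
  IsLineSubdividedStar (G.induce S)

/-- Reachability inside a vertex set `A`. -/
def Reaches (G : SimpleGraph V) (A : Set V) (u v : V) : Prop :=
  ∃ (w : G.Walk u v), ∀ z ∈ w.support, z ∈ A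

/-- `Pw` is a spine of the caterpillar `G[S]`: a maximal path containing all branch vertices. -/
def IsSpineOf (G : SimpleGraph V) (S : Set V) {p q : V} (Pw : G.Walk p q) : Prop :=
  Pw.IsPath ∧ (∀ w ∈ Pw.support, w ∈ S) ∧
  (∀ v ∈ S, 3 ≤ ({u | u ∈ S ∧ G.Adj v u}).ncard → v ∈ Pw.support) ∧
  ∀ (p' q' : V) (P' : G.Walk p' q'), P'.IsPath → (∀ w ∈ P'.support, w ∈ S) →
    (∀ w ∈ Pw.support, w ∈ P'.support) → ∀ w ∈ P'.support, w ∈ Pw.support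

/-- `Pw` realizes `P(H)` for `H = G[S]`, when `H` is a caterpillar or the line graph
of a caterpillar. -/
def IsPHOf (G : SimpleGraph V) (S : Set V) {p q : V} (Pw : G.Walk p q) : Prop :=
  Pw.IsPath ∧ (∀ w ∈ Pw.support, w ∈ S) ∧
  ( (IsCaterpillar (G.induce S) ∧ IsSpineOf G S Pw) ∨
    (∃ (W : Type) (T : SimpleGraph W) (φ : T.lineGraph ≃g G.induce S)
        (x y : W) (Q : T.Walk x y),
      IsCaterpillar T ∧ Q.IsPath ∧
      (∀ v, BranchVtx T v → v ∈ Q.support) ∧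
      (∀ (x' y' : W) (Q' : T.Walk x' y'), Q'.IsPath →
        (∀ w ∈ Q.support, w ∈ Q'.support) → ∀ w ∈ Q'.support, w ∈ Q.support) ∧
      {w | w ∈ Pw.support} = {v : V | ∃ e : T.edgeSet, (e : Sym2 W) ∈ Q.edges ∧ ↑(φ e) = v}) )

/-- `x` enumerates `X` in the order given by the (non-concentrated) connectifier `(G[S], X)`
with central path `Pw = P(H)`. -/
def ConnectifierOrder (G : SimpleGraph V) (S : Set V) (X : Finset V)
    {p q : V} (Pw : G.Walk p q) {k : ℕ} (x : Fin k → V) : Prop :=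
  Function.Injective x ∧ (∀ l, x l ∈ X) ∧ (∀ z ∈ X, ∃ l, x l = z) ∧
  ∃ (s : Fin k → V) (lo hi : Fin k → ℕ),
    (∀ l, lo l ≤ hi l) ∧ (∀ l m : Fin k, l < m → hi l < lo m) ∧
    (∀ l, hi l < Pw.support.length) ∧
    (∀ (l : Fin k) (n : Fin Pw.support.length),
      G.Adj (s l) (Pw.support.get n) → lo l ≤ (n : ℕ) ∧ (n : ℕ) ≤ hi l) ∧
    ∀ l : Fin k, s l ∈ S ∧ s l ∉ Pw.support ∧ (∃ u ∈ Pw.support, G.Adj (s l) u) ∧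
      ∀ r ∈ S, G.Adj (x l) r → Reaches G (S \ {w | w ∈ Pw.support}) r (s l)

/-- `(G[S], X)` is a consistent alignment (with `G[S]` a path). -/
def ConsistentAlignmentSet (G : SimpleGraph V) (S : Set V) (X : Finset V) : Prop :=
  ∃ (p q : V) (Pw : G.Walk p q), Pw.IsPath ∧ InducedWalk G Pw ∧
    {w | w ∈ Pw.support} = S ∧ ConsistentAlignment G Pw X

/-- The orders on `X` given by `(D1, X)` and by `(G[S], X)` coincide. -/
def OrdersAgree (G : SimpleGraph V) {p q : V} (D1w : G.Walk p q)
    (S : Set V) (X : Finset V) : Prop :=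
  ∃ (k : ℕ) (x : Fin k → V),
    AlignmentOrder G D1w X x ∧
    ( (∃ (p' q' : V) (Pw : G.Walk p' q'), IsPHOf G S Pw ∧ ConnectifierOrder G S X Pw x) ∨
      (∃ (p' q' : V) (Pw : G.Walk p' q'), Pw.IsPath ∧ InducedWalk G Pw ∧
        {w | w ∈ Pw.support} = S ∧ AlignmentOrder G Pw X x) )

/-- `(D1, Y, D2)` is an `s`-trisection of `G`, where `D1` is (the support of) the path `D1w`. -/
def IsTrisection (G : SimpleGraph V) (s : ℕ) {p q : V} (D1w : G.Walk p q)
    (Y D2 : Set V) : Prop :=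
  D1w.IsPath ∧ InducedWalk G D1w ∧
  (∀ w ∈ D1w.support, w ∉ Y ∧ w ∉ D2) ∧ Disjoint Y D2 ∧
  ({w | w ∈ D1w.support} ∪ Y ∪ D2 = Set.univ) ∧
  D2.Nonempty ∧
  (∀ a ∈ D1w.support, ∀ b ∈ D2, ¬ G.Adj a b) ∧
  StableSet G Y ∧ Y.ncard = s ∧
  OpenNbhd G {w | w ∈ D1w.support} = Y ∧ OpenNbhd G D2 = Y ∧
  (∀ y ∈ Y, ∃ d ∈ D1w.support, ∀ z ∈ Y, (G.Adj d z ↔ z = y))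

/-- The conclusion of amiability for the trisection `(D1w, Y, D2)` with parameter `x`:
the pair `(G[S], X)` is "given by amiability". -/
def AmiableOutcome (G : SimpleGraph V) {p q : V} (D1w : G.Walk p q)
    (Y D2 : Set V) (x : ℕ) (S : Set V) (X : Finset V) : Prop :=
  S ⊆ D2 ∧ ↑X ⊆ Y ∧ X.card = x ∧
  ConsistentAlignment G D1w X ∧
  (IsConnectifier G S X ∨ ConsistentAlignmentSet G S X) ∧
  (¬ (IsConnectifier G S X ∧ Concentrated G S) → OrdersAgree G D1w S X)


section Reachability

variable {G : SimpleGraph V} {A B : Set V} {u v w : V}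

theorem Reaches.mono (hAB : A ⊆ B) (h : Reaches G A u v) : Reaches G B u v :=
  let ⟨q, hq⟩ := h
  ⟨q, fun z hz => hAB (hq z hz)⟩

theorem Reaches.symm (h : Reaches G A u v) : Reaches G A v u :=
  let ⟨q, hq⟩ := h
  ⟨q.reverse, fun z hz => hq z (by simpa using hz)⟩

theorem Reaches.trans (h₁ : Reaches G A u v) (h₂ : Reaches G A v w) : Reaches G A u w := by
  obtain ⟨q, hq⟩ := h₁
  obtain ⟨r, hr⟩ := h₂
  refine ⟨q.append r, fun z hz => ?_⟩
  rcases (Walk.mem_support_append_iff _ _).1 hz with hz | hz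
  exacts [hq z hz, hr z hz]

theorem Reaches.of_adj (h : G.Adj u v) (hu : u ∈ A) (hv : v ∈ A) : Reaches G A u v :=
  ⟨h.toWalk, fun z hz => by
    have : z = u ∨ z = v := by simpa using hz
    rcases this with rfl | rfl <;> assumption⟩

theorem Reaches.refl (hu : u ∈ A) : Reaches G A u u :=
  ⟨Walk.nil, fun z hz => by
    have : z = u := by simpa using hz
    rwa [this]⟩

theorem Reaches.of_segment {f : ℕ → V} {i j : ℕ} (hij : i ≤ j)
    (hadj : ∀ k, i ≤ k → k < j → G.Adj (f k) (f (k + 1)))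
    (hmem : ∀ k, i ≤ k → k ≤ j → f k ∈ A) : Reaches G A (f i) (f j) := by
  induction j, hij using Nat.le_induction with
  | base => exact .refl (hmem i le_rfl le_rfl)
  | succ j hij ih =>
    exact (ih (fun k h₁ h₂ => hadj k h₁ (by omega)) fun k h₁ h₂ => hmem k h₁ (by omega)).trans
      (.of_adj (hadj j hij (by omega)) (hmem j hij (by omega)) (hmem _ (by omega) le_rfl))

/-- A shortest walk inside a vertex set is an induced path. -/
theorem Reaches.exists_inducedPath (h : Reaches G A u v) :
    ∃ q : G.Walk u v, q.IsPath ∧ InducedWalk G q ∧ ∀ z ∈ q.support, z ∈ A := by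
  classical
  have hex : ∃ n, ∃ q : G.Walk u v, (∀ z ∈ q.support, z ∈ A) ∧ q.length = n :=
    let ⟨q, hq⟩ := h
    ⟨_, q, hq, rfl⟩
  obtain ⟨q, hq, hlen⟩ := Nat.find_spec hex
  have hmin : ∀ r : G.Walk u v, (∀ z ∈ r.support, z ∈ A) → q.length ≤ r.length := fun r hr => by
    rw [hlen]
    exact Nat.find_min' hex ⟨r, hr, rfl⟩
  have hchord : ∀ i j, i < j → j ≤ q.length → G.Adj (q.getVert i) (q.getVert j) →
      s(q.getVert i, q.getVert j) ∈ q.edges := by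
    intro i j hij hj hadj
    have := hmin ((q.take i).append (Walk.cons hadj (q.drop j))) fun z hz => by
      rw [Walk.mem_support_append_iff, Walk.support_cons, List.mem_cons] at hz
      rcases hz with hz | rfl | hz
      · exact hq z (by rw [Walk.support_take] at hz; exact List.mem_of_mem_take hz)
      · exact hq _ (q.getVert_mem_support i)
      · refine hq z ?_
        rw [Walk.drop_support_eq_support_drop_min] at hz
        exact List.mem_of_mem_drop hz
    rw [Walk.length_append, Walk.length_cons, Walk.take_length, Walk.drop_length] at this
    obtain rfl : j = i + 1 := by omega
    have hi : i < q.edges.length := by simpa using hij.trans_le hj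
    rw [← Walk.getElem_edges hi]
    exact List.getElem_mem hi
  refine ⟨q, ?_, ?_, hq⟩
  · have hle := hmin q.bypass fun z hz => hq z (q.support_bypass_subset_support hz)
    rw [← q.bypass_eq_self_of_length_le_length_bypass hle]
    exact q.bypass_isPath
  · intro x hx y hy hadj
    obtain ⟨i, rfl, hi⟩ := Walk.mem_support_iff_exists_getVert.1 hx
    obtain ⟨j, rfl, hj⟩ := Walk.mem_support_iff_exists_getVert.1 hy
    rcases lt_trichotomy i j with hij | rfl | hij
    · exact hchord i j hij hj hadj
    · exact absurd hadj G.irrefl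
    · rw [Sym2.eq_swap]
      exact hchord j i hij hi hadj.symm

end Reachability

section Constructions

variable {G : SimpleGraph V}

theorem two_le_length {u v : V} (hne : u ≠ v) (hadj : ¬ G.Adj u v) (q : G.Walk u v) :
    2 ≤ q.length := by
  match q with
  | .nil => exact absurd rfl hne
  | .cons h .nil => exact absurd h hadj
  | .cons _ (.cons _ _) => simp

/-- Three pairwise anticomplete sets, each linking two non-adjacent vertices, give a theta. -/
theorem containsTheta_of_reaches {a b : V} {A₁ A₂ A₃ : Set V} (hne : a ≠ b)
    (hadj : ¬ G.Adj a b)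
    (h₁ : Reaches G (insert a (insert b A₁)) a b)
    (h₂ : Reaches G (insert a (insert b A₂)) a b)
    (h₃ : Reaches G (insert a (insert b A₃)) a b)
    (d₁₂ : Disjoint A₁ A₂) (d₁₃ : Disjoint A₁ A₃) (d₂₃ : Disjoint A₂ A₃)
    (c₁₂ : Anticomplete G A₁ A₂) (c₁₃ : Anticomplete G A₁ A₃) (c₂₃ : Anticomplete G A₂ A₃) :
    ContainsTheta G := by
  obtain ⟨q₁, p₁, i₁, s₁⟩ := h₁.exists_inducedPath
  obtain ⟨q₂, p₂, i₂, s₂⟩ := h₂.exists_inducedPath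
  obtain ⟨q₃, p₃, i₃, s₃⟩ := h₃.exists_inducedPath
  have sub : ∀ {q : G.Walk a b} {A : Set V},
      (∀ z ∈ q.support, z ∈ insert a (insert b A)) → Interior q ⊆ A :=
    fun hs z ⟨hz, hza, hzb⟩ => ((hs z hz).resolve_left hza).resolve_left hzb
  have anti : ∀ {q r : G.Walk a b} {A B : Set V}, Interior q ⊆ A → Interior r ⊆ B →
      Anticomplete G A B → Anticomplete G (Interior q) (Interior r) :=
    fun hq hr h x hx y hy => h x (hq hx) y (hr hy)
  exact ⟨a, b, q₁, q₂, q₃, hne, hadj, p₁, p₂, p₃, i₁, i₂, i₃,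
    two_le_length hne hadj _, two_le_length hne hadj _, two_le_length hne hadj _,
    d₁₂.mono (sub s₁) (sub s₂), d₁₃.mono (sub s₁) (sub s₃), d₂₃.mono (sub s₂) (sub s₃),
    anti (sub s₁) (sub s₂) c₁₂, anti (sub s₁) (sub s₃) c₁₃, anti (sub s₂) (sub s₃) c₂₃⟩

/-- A vertex `c` together with two disjoint sets linking `p` to `p'` and `b` to `b'`, where
`cpb` and `cp'b'` are triangles and there are no further edges, gives a prism. -/
theorem containsPrism_of_reaches {c p p' b b' : V} {A B : Set V}
    (hcp : G.Adj c p) (hcb : G.Adj c b) (hpb : G.Adj p b)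
    (hcp' : G.Adj c p') (hcb' : G.Adj c b') (hpb' : G.Adj p' b')
    (hA : Reaches G A p p') (hB : Reaches G B b b')
    (hcA : c ∉ A) (hcB : c ∉ B) (hAB : Disjoint A B)
    (hA' : ∀ x ∈ A, G.Adj c x → x = p ∨ x = p')
    (hB' : ∀ x ∈ B, G.Adj c x → x = b ∨ x = b')
    (hcross : ∀ x ∈ A, ∀ y ∈ B, G.Adj x y → x = p ∧ y = b ∨ x = p' ∧ y = b')
    (hpp : p ≠ p') (hpp' : ¬ G.Adj p p') (hbb : b ≠ b') (hbb' : ¬ G.Adj b b') :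
    ContainsPrism G := by
  obtain ⟨q, pq, iq, sq⟩ := hA.exists_inducedPath
  obtain ⟨r, pr, ir, sr⟩ := hB.exists_inducedPath
  have lq := two_le_length hpp hpp' q
  have lr := two_le_length hbb hbb' r
  have hdis : ∀ x, x ∈ q.support → x ∉ r.support := fun x hx hy =>
    Set.disjoint_left.1 hAB (sq x hx) (sr x hy)
  have hcq : c ∉ q.support := fun h => hcA (sq _ h)
  have hcr : c ∉ r.support := fun h => hcB (sr _ h)
  have hq' := fun x hx => hA' x (sq x hx)
  have hr' := fun x hx => hB' x (sr x hx)
  have hcross' := fun x hx y hy => hcross x (sq x hx) y (sr y hy)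
  refine ⟨![c, p, b], ![c, p', b'],
    Fin.cons (α := fun i => G.Walk ((![c, p, b] : Fin 3 → V) i) ((![c, p', b'] : Fin 3 → V) i))
      (Walk.nil : G.Walk c c) (Fin.cons q (Fin.cons r finZeroElim)),
    ?_, ?_, ?_, ?_, ?_, ?_, ?_⟩
  · intro i j hij
    fin_cases i <;> fin_cases j <;> simp_all [G.adj_comm]
  · intro i j hij
    fin_cases i <;> fin_cases j <;> simp_all [G.adj_comm]
  · intro i
    fin_cases i
    exacts [Walk.IsPath.nil, pq, pr]
  · intro i
    fin_cases i
    · intro x hx y hy hadj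
      obtain rfl : x = c := List.mem_singleton.1 hx
      obtain rfl : y = x := List.mem_singleton.1 hy
      exact absurd hadj G.irrefl
    exacts [iq, ir]
  · intro i j hij x hx hy
    fin_cases i <;> fin_cases j <;> first | exact hij rfl | skip
    · obtain rfl : x = c := List.mem_singleton.1 hx
      exact hcq hy
    · obtain rfl : x = c := List.mem_singleton.1 hx
      exact hcr hy
    · obtain rfl : x = c := List.mem_singleton.1 hy
      exact hcq hx
    · exact hdis x hx hy
    · obtain rfl : x = c := List.mem_singleton.1 hy
      exact hcr hx
    · exact hdis x hy hx
  · intro i j hij x hx y hy hadj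
    fin_cases i <;> fin_cases j <;> first | exact absurd rfl hij | skip
    · obtain rfl : x = c := List.mem_singleton.1 hx
      exact (hq' y hy hadj).imp (⟨rfl, ·⟩) (⟨rfl, ·⟩)
    · obtain rfl : x = c := List.mem_singleton.1 hx
      exact (hr' y hy hadj).imp (⟨rfl, ·⟩) (⟨rfl, ·⟩)
    · obtain rfl : y = c := List.mem_singleton.1 hy
      exact (hq' x hx hadj.symm).imp (⟨·, rfl⟩) (⟨·, rfl⟩)
    · exact hcross' x hx y hy hadj
    · obtain rfl : y = c := List.mem_singleton.1 hy
      exact (hr' x hx hadj.symm).imp (⟨·, rfl⟩) (⟨·, rfl⟩)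
    · exact (hcross' y hy x hx hadj.symm).imp And.symm And.symm
  · intro i j hij
    fin_cases i <;> fin_cases j <;> first | exact absurd rfl hij | skip
    · exact lq.trans (Nat.le_add_left _ _)
    · exact lr.trans (Nat.le_add_left _ _)
    · exact lq.trans (Nat.le_add_right _ _)
    · exact lq.trans (Nat.le_add_right _ _)
    · exact lr.trans (Nat.le_add_right _ _)
    · exact lr.trans (Nat.le_add_right _ _)

end Constructions

section HoleIndexing

variable {G : SimpleGraph V}

/-- The vertices `f 0, …, f (n - 1)` form an induced cycle of `G`, in this cyclic order. -/
structure IsHoleIndexing (G : SimpleGraph V) (n : ℕ) (f : ℕ → V) : Prop where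
  inj : ∀ i j, i < n → j < n → f i = f j → i = j
  adj_iff : ∀ i j, i < j → j < n → (G.Adj (f i) (f j) ↔ j = i + 1 ∨ i = 0 ∧ j = n - 1)

variable {n : ℕ} {f : ℕ → V}

theorem IsHoleIndexing.adj_succ (hf : IsHoleIndexing G n f) {i : ℕ} (hi : i + 1 < n) :
    G.Adj (f i) (f (i + 1)) :=
  (hf.adj_iff i (i + 1) (by omega) hi).2 (.inl rfl)

theorem IsHoleIndexing.reaches (hf : IsHoleIndexing G n f) {A : Set V} {i j : ℕ} (hij : i ≤ j)
    (hj : j < n) (hmem : ∀ k, i ≤ k → k ≤ j → f k ∈ A) : Reaches G A (f i) (f j) :=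
  .of_segment hij (fun _ _ _ => hf.adj_succ (by omega)) hmem

theorem IsHoleIndexing.disjoint_image (hf : IsHoleIndexing G n f) {I J : Set ℕ}
    (h : ∀ i ∈ I, ∀ j ∈ J, i < j ∧ j < n) : Disjoint (f '' I) (f '' J) := by
  rw [Set.disjoint_left]
  rintro _ ⟨i, hi, rfl⟩ ⟨j, hj, hij⟩
  have := h i hi j hj
  have := hf.inj j i this.2 (this.1.trans this.2) hij
  omega

theorem IsHoleIndexing.anticomplete_image (hf : IsHoleIndexing G n f) {I J : Set ℕ}
    (h : ∀ i ∈ I, ∀ j ∈ J, i + 1 < j ∧ j < n ∧ (0 < i ∨ j + 1 < n)) :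
    Anticomplete G (f '' I) (f '' J) := by
  rintro _ ⟨i, hi, rfl⟩ _ ⟨j, hj, rfl⟩ hij
  have := h i hi j hj
  have := (hf.adj_iff i j (by omega) this.2.1).1 hij
  omega

/-- If both `c` and `v` have neighbors far away from the sector `f 0, …, f L` of `c`, and `v`
attaches to this sector at one vertex or at two non-adjacent extreme vertices, there is a theta. -/
theorem IsHoleIndexing.containsTheta (hf : IsHoleIndexing G n f) {c v : V} {L i j k m : ℕ}
    (hcf : ∀ l < n, c ≠ f l) (hvf : ∀ l < n, v ≠ f l) (hvc : v ≠ c) (hvc' : ¬ G.Adj v c)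
    (hc0 : G.Adj c (f 0)) (hcL : G.Adj c (f L))
    (hcint : ∀ l, 0 < l → l < L → ¬ G.Adj c (f l))
    (hi : 0 < i) (hj : j < L) (hij : i = j ∨ i + 2 ≤ j)
    (hvi : G.Adj v (f i)) (hvj : G.Adj v (f j))
    (hv : ∀ l ≤ L, G.Adj v (f l) → i ≤ l ∧ l ≤ j)
    (hk : L + 1 < k) (hk' : k + 1 < n) (hvk : G.Adj v (f k))
    (hm : L + 1 < m) (hm' : m + 1 < n) (hcm : G.Adj c (f m)) :
    ContainsTheta G := by
  have hkm : Reaches G (f '' Set.Ioo (L + 1) (n - 1)) (f m) (f k) := by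
    rcases le_total m k with h | h
    · exact hf.reaches h (by omega) fun l h₁ h₂ => ⟨l, ⟨by omega, by omega⟩, rfl⟩
    · refine (hf.reaches h (by omega) fun l h₁ h₂ => ?_).symm
      exact ⟨l, ⟨by omega, by omega⟩, rfl⟩
  have hmR : f m ∈ f '' Set.Ioo (L + 1) (n - 1) := ⟨m, ⟨hm, by omega⟩, rfl⟩
  have hkR : f k ∈ f '' Set.Ioo (L + 1) (n - 1) := ⟨k, ⟨hk, by omega⟩, rfl⟩
  rcases hij with rfl | hij
  · have anti_v : ∀ I : Set ℕ, (∀ l ∈ I, l ≤ L ∧ l ≠ i) → Anticomplete G (f '' I)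
        (insert v (f '' Set.Ioo (L + 1) (n - 1))) := by
      rintro I hI _ ⟨l, hl, rfl⟩ y (rfl | hy) hadj
      · have := hv l (hI l hl).1 hadj.symm
        have := (hI l hl).2
        omega
      · refine hf.anticomplete_image (I := I) (J := Set.Ioo (L + 1) (n - 1)) ?_ _ ⟨l, hl, rfl⟩
          _ hy hadj
        rintro a ha b ⟨hb, hb'⟩
        have := (hI a ha).1
        omega
    have disj_v : ∀ I : Set ℕ, (∀ l ∈ I, l ≤ L) → Disjoint (f '' I)
        (insert v (f '' Set.Ioo (L + 1) (n - 1))) := by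
      intro I hI
      rw [Set.disjoint_insert_right]
      refine ⟨?_, hf.disjoint_image (J := Set.Ioo (L + 1) (n - 1)) ?_⟩
      · rintro ⟨l, hl, hlv⟩
        exact hvf l (by have := hI l hl; omega) hlv.symm
      · rintro a ha b ⟨hb, hb'⟩
        have := hI a ha
        omega
    refine containsTheta_of_reaches (a := c) (b := f i) (A₁ := f '' Set.Iio i)
      (A₂ := f '' Set.Ioc i L) (A₃ := insert v (f '' Set.Ioo (L + 1) (n - 1)))
      (hcf i (by omega)) (hcint i hi hj) ?_ ?_ ?_ (hf.disjoint_image ?_) (disj_v _ ?_) (disj_v _ ?_)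
      (hf.anticomplete_image ?_) (anti_v _ ?_) (anti_v _ ?_)
    · refine (Reaches.of_adj hc0 (.inl rfl) ?_).trans (hf.reaches (by omega) (by omega) ?_)
      · exact .inr (.inr ⟨0, hi, rfl⟩)
      · intro l _ hl
        rcases hl.eq_or_lt with rfl | hl
        exacts [.inr (.inl rfl), .inr (.inr ⟨l, hl, rfl⟩)]
    · refine (Reaches.of_adj hcL (.inl rfl) ?_).trans (hf.reaches hj.le (by omega) ?_).symm
      · exact .inr (.inr ⟨L, ⟨hj, le_rfl⟩, rfl⟩)
      · intro l hl hl'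
        rcases hl.eq_or_lt with rfl | hl
        exacts [.inr (.inl rfl), .inr (.inr ⟨l, ⟨hl, hl'⟩, rfl⟩)]
    · refine (Reaches.of_adj hcm (.inl rfl) (.inr (.inr (.inr hmR)))).trans
        ((hkm.mono fun x hx => .inr (.inr (.inr hx))).trans
        ((Reaches.of_adj hvk.symm (.inr (.inr (.inr hkR))) (.inr (.inr (.inl rfl)))).trans
        (.of_adj hvi (.inr (.inr (.inl rfl))) (.inr (.inl rfl)))))
    all_goals grind
  · refine containsTheta_of_reaches (a := c) (b := v) (A₁ := f '' Set.Iic i)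
      (A₂ := f '' Set.Icc j L) (A₃ := f '' Set.Ioo (L + 1) (n - 1))
      hvc.symm (fun h => hvc' h.symm) ?_ ?_ ?_ (hf.disjoint_image ?_) (hf.disjoint_image ?_)
      (hf.disjoint_image ?_) (hf.anticomplete_image ?_) (hf.anticomplete_image ?_)
      (hf.anticomplete_image ?_)
    · exact (Reaches.of_adj hc0 (.inl rfl) (.inr (.inr ⟨0, Nat.zero_le _, rfl⟩))).trans
        ((hf.reaches (Nat.zero_le i) (by omega) fun l _ hl => .inr (.inr ⟨l, hl, rfl⟩)).trans
        (.of_adj hvi.symm (.inr (.inr ⟨i, le_refl i, rfl⟩)) (.inr (.inl rfl))))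
    · exact (Reaches.of_adj hcL (.inl rfl) (.inr (.inr ⟨L, ⟨hj.le, le_rfl⟩, rfl⟩))).trans
        ((hf.reaches hj.le (by omega) fun l hl hl' => .inr (.inr ⟨l, ⟨hl, hl'⟩, rfl⟩)).symm.trans
        (.of_adj hvj.symm (.inr (.inr ⟨j, ⟨le_rfl, hj.le⟩, rfl⟩)) (.inr (.inl rfl))))
    · exact (Reaches.of_adj hcm (.inl rfl) (.inr (.inr hmR))).trans
        ((hkm.mono fun x hx => .inr (.inr hx)).trans
        (.of_adj hvk.symm (.inr (.inr hkR)) (.inr (.inl rfl))))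
    all_goals grind

/-- A hole together with a vertex whose neighbors on it are the four ends of two disjoint
long arcs covering the hole is a prism. -/
theorem IsHoleIndexing.containsPrism (hf : IsHoleIndexing G n f) {c : V} {L : ℕ}
    (hL : 2 ≤ L) (hLn : L + 3 < n) (hcf : ∀ l < n, c ≠ f l)
    (hc : ∀ l < n, G.Adj c (f l) ↔ l = 0 ∨ l = L ∨ l = L + 1 ∨ l = n - 1) :
    ContainsPrism G := by
  have notMem : ∀ I : Set ℕ, (∀ l ∈ I, l < n) → c ∉ f '' I := by
    rintro I hI ⟨l, hl, hlc⟩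
    exact hcf l (hI l hl) hlc.symm
  have hB : Reaches G (f '' Set.Ioo L n) (f (n - 1)) (f (L + 1)) := by
    refine (hf.reaches (by omega) (by omega) fun l h₁ h₂ => ?_).symm
    exact ⟨l, ⟨by omega, by omega⟩, rfl⟩
  refine containsPrism_of_reaches (c := c) (p := f 0) (p' := f L) (b := f (n - 1))
    (b' := f (L + 1)) (A := f '' Set.Iic L) (B := f '' Set.Ioo L n)
    ((hc _ (by omega)).2 (by omega)) ((hc _ (by omega)).2 (by omega))
    ((hf.adj_iff _ _ (by omega) (by omega)).2 (by omega))
    ((hc _ (by omega)).2 (by omega)) ((hc _ (by omega)).2 (by omega))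
    ((hf.adj_iff _ _ (by omega) (by omega)).2 (by omega))
    (hf.reaches (Nat.zero_le L) (by omega) fun l _ hl => ⟨l, hl, rfl⟩)
    hB
    (notMem _ fun l hl => by have : l ≤ L := hl; omega) (notMem _ fun l hl => hl.2)
    (hf.disjoint_image (I := Set.Iic L) (J := Set.Ioo L n)
      fun i hi j hj => ⟨lt_of_le_of_lt hi hj.1, hj.2⟩) ?_ ?_ ?_ ?_ ?_ ?_ ?_
  · rintro _ ⟨l, hl, rfl⟩ h
    have hl : l ≤ L := hl
    have := (hc l (by omega)).1 h
    obtain rfl | rfl : l = 0 ∨ l = L := by omega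
    exacts [.inl rfl, .inr rfl]
  · rintro _ ⟨l, hl, rfl⟩ h
    have := (hc l hl.2).1 h
    have := hl.1
    obtain rfl | rfl : l = n - 1 ∨ l = L + 1 := by omega
    exacts [.inl rfl, .inr rfl]
  · rintro _ ⟨i, hi, rfl⟩ _ ⟨j, ⟨hj, hj'⟩, rfl⟩ h
    have hi : i ≤ L := hi
    have := (hf.adj_iff i j (by omega) hj').1 h
    obtain ⟨rfl, rfl⟩ | ⟨rfl, rfl⟩ : (i = 0 ∧ j = n - 1) ∨ (i = L ∧ j = L + 1) := by omega
    exacts [.inl ⟨rfl, rfl⟩, .inr ⟨rfl, rfl⟩]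
  · intro h
    have := hf.inj _ _ (by omega) (by omega) h
    omega
  · intro h
    have := (hf.adj_iff _ _ (by omega) (by omega)).1 h
    omega
  · intro h
    have := hf.inj _ _ (by omega) (by omega) h
    omega
  · intro h
    have := (hf.adj_iff _ _ (by omega) (by omega)).1 h.symm
    omega

end HoleIndexing

section Walks

variable {G : SimpleGraph V}

/-- The vertices of a hole, in the order of traversal, form a hole indexing. -/
theorem IsHoleWalk.isHoleIndexing {u : V} {H : G.Walk u u} (hH : IsHoleWalk G H) :
    IsHoleIndexing G H.length H.getVert := by
  obtain ⟨hcyc, h4, hind⟩ := hH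
  have inj : ∀ i j, i < H.length → j < H.length → H.getVert i = H.getVert j → i = j :=
    fun i j hi hj h => hcyc.getVert_injOn' (by simp; omega) (by simp; omega) h
  refine ⟨inj, fun i j hij hj => ⟨fun hadj => ?_, ?_⟩⟩
  · have := hind _ (H.getVert_mem_support i) _ (H.getVert_mem_support j) hadj
    obtain ⟨k, hk, hke⟩ := List.getElem_of_mem this
    rw [Walk.getElem_edges] at hke
    rw [Walk.length_edges] at hk
    have hwrap : k + 1 < H.length ∨
        k = H.length - 1 ∧ H.getVert (k + 1) = H.getVert 0 := by
      by_cases h : k + 1 < H.length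
      · exact .inl h
      · have : k + 1 = H.length := by omega
        exact .inr ⟨by omega, by rw [this, Walk.getVert_length, Walk.getVert_zero]⟩
    rcases Sym2.eq_iff.1 hke with ⟨h₁, h₂⟩ | ⟨h₁, h₂⟩
    · have e₁ := inj _ _ hk (by omega) h₁
      rcases hwrap with h | ⟨h, hw⟩
      · have e₂ := inj _ _ h hj h₂
        omega
      · have e₂ := inj _ _ (by omega) hj (hw.symm.trans h₂)
        omega
    · have e₁ := inj _ _ hk (by omega) h₁
      rcases hwrap with h | ⟨h, hw⟩
      · have e₂ := inj _ _ h (by omega) h₂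
        omega
      · have e₂ := inj _ _ (by omega) (by omega) (hw.symm.trans h₂)
        omega
  · rintro (rfl | ⟨rfl, rfl⟩)
    · exact H.adj_getVert_succ (by omega)
    · have := H.adj_getVert_succ (i := H.length - 1) (by omega)
      rw [Nat.sub_add_cancel (by omega), Walk.getVert_length] at this
      rw [Walk.getVert_zero]
      exact this.symm

theorem IsHoleWalk.mem_support_iff {u x : V} {H : G.Walk u u} (hH : IsHoleWalk G H) :
    x ∈ H.support ↔ ∃ i < H.length, H.getVert i = x := by
  constructor
  · intro hx
    obtain ⟨i, hi, hi'⟩ := Walk.mem_support_iff_exists_getVert.1 hx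
    have := hH.2.1
    rcases hi'.eq_or_lt with h | h
    · exact ⟨0, by omega, by rw [← hi, h, Walk.getVert_length, Walk.getVert_zero]⟩
    · exact ⟨i, h, hi⟩
  · rintro ⟨i, -, rfl⟩
    exact H.getVert_mem_support i

theorem IsHoleWalk.reverse {u : V} {H : G.Walk u u} (hH : IsHoleWalk G H) :
    IsHoleWalk G H.reverse := by
  refine ⟨hH.1.reverse, by simpa using hH.2.1, fun x hx y hy h => ?_⟩
  rw [Walk.support_reverse, List.mem_reverse] at hx hy
  rw [Walk.edges_reverse, List.mem_reverse]
  exact hH.2.2 x hx y hy h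

theorem IsHoleWalk.rotate [DecidableEq V] {u w : V} {H : G.Walk u u} (hH : IsHoleWalk G H)
    (hw : w ∈ H.support) : IsHoleWalk G (H.rotate w hw) := by
  refine ⟨hH.1.rotate hw, by simpa using hH.2.1, fun x hx y hy h => ?_⟩
  rw [Walk.mem_support_rotate_iff] at hx hy
  exact (H.rotate_edges w hw).mem_iff.2 (hH.2.2 x hx y hy h)

/-- A path in a hole that agrees with the hole in its first edge follows the hole. -/
theorem IsHoleWalk.getVert_eq {p p' : V} {H : G.Walk p p} (hH : IsHoleWalk G H)
    {P : G.Walk p p'} (hP : P.IsPath) (hPH : ∀ x ∈ P.support, x ∈ H.support)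
    (h1 : P.getVert 1 = H.getVert 1) :
    ∀ i ≤ P.length, i < H.length ∧ P.getVert i = H.getVert i := by
  have hI := hH.isHoleIndexing
  have h4 := hH.2.1
  intro i
  induction i using Nat.strong_induction_on with
  | _ i ih =>
    intro hi
    match i with
    | 0 => exact ⟨by omega, by simp⟩
    | 1 => exact ⟨by omega, h1⟩
    | i + 2 =>
      obtain ⟨-, e₀⟩ := ih i (by omega) (by omega)
      obtain ⟨hlt, e₁⟩ := ih (i + 1) (by omega) (by omega)
      have hadj := P.adj_getVert_succ (i := i + 1) (by omega)
      obtain ⟨j, hj, hje⟩ := hH.mem_support_iff.1 (hPH _ (P.getVert_mem_support (i + 2)))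
      have hji : j ≠ i := by
        rintro rfl
        have : j + 2 = j := hP.getVert_injOn hi (by simp; omega) (hje.symm.trans e₀.symm)
        omega
      have hj0 : j ≠ 0 := by
        rintro rfl
        have : i + 2 = 0 := hP.getVert_injOn hi (by simp) (hje.symm.trans (by simp))
        omega
      rw [e₁, ← hje] at hadj
      have : j = i + 2 := by
        rcases lt_trichotomy j (i + 1) with h | rfl | h
        · have := (hI.adj_iff _ _ h hlt).1 hadj.symm
          omega
        · exact absurd hadj G.irrefl
        · have := (hI.adj_iff _ _ h hj).1 hadj
          omega
      subst this
      exact ⟨hj, hje.symm⟩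

/-- A hole containing a path can be traversed so that it starts with this path. -/
theorem IsHoleWalk.exists_indexing {u p p' : V} {H : G.Walk u u} (hH : IsHoleWalk G H)
    {P : G.Walk p p'} (hP : P.IsPath) (hP0 : 0 < P.length)
    (hPH : ∀ x ∈ P.support, x ∈ H.support) :
    ∃ f : ℕ → V, IsHoleIndexing G H.length f ∧
      (∀ x, x ∈ H.support ↔ ∃ i < H.length, f i = x) ∧ P.length < H.length ∧
      ∀ i ≤ P.length, P.getVert i = f i := by
  classical
  have hp := hPH p P.start_mem_support
  have main : ∀ K : G.Walk p p, IsHoleWalk G K → K.length = H.length →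
      (∀ x, x ∈ K.support ↔ x ∈ H.support) → P.getVert 1 = K.getVert 1 →
      ∃ f : ℕ → V, IsHoleIndexing G H.length f ∧
        (∀ x, x ∈ H.support ↔ ∃ i < H.length, f i = x) ∧ P.length < H.length ∧
        ∀ i ≤ P.length, P.getVert i = f i := by
    intro K hK hlen hsupp h1
    have := hK.getVert_eq hP (fun x hx => (hsupp x).2 (hPH x hx)) h1
    refine ⟨K.getVert, hlen ▸ hK.isHoleIndexing, fun x => ?_, ?_, fun i hi => (this i hi).2⟩
    · rw [← hsupp, hK.mem_support_iff, hlen]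
    · rw [← hlen]
      exact (this _ le_rfl).1
  set K := H.rotate p hp with hKdef
  have hK : IsHoleWalk G K := hH.rotate hp
  have hlen : K.length = H.length := by simp [hKdef]
  have hsupp : ∀ x, x ∈ K.support ↔ x ∈ H.support := by simp [hKdef]
  obtain ⟨j, hj, hje⟩ := hK.mem_support_iff.1 ((hsupp _).2 (hPH _ (P.getVert_mem_support 1)))
  have hadj : G.Adj (K.getVert 0) (K.getVert j) := by
    simpa [hje] using P.adj_getVert_succ hP0
  have hj0 : 0 < j := Nat.pos_of_ne_zero fun h => by
    subst h
    exact G.irrefl hadj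
  rcases (hK.isHoleIndexing.adj_iff 0 j hj0 hj).1 hadj with rfl | ⟨-, rfl⟩
  · exact main K hK hlen hsupp hje.symm
  · refine main K.reverse hK.reverse (by simpa) (by simpa) ?_
    rw [Walk.getVert_reverse, hje]

end Walks

/-- The neighbors of `v` among `f 0, …, f L` lie between two extreme ones. -/
theorem exists_extreme_neighbors {G : SimpleGraph V} {f : ℕ → V} {v : V} {L k : ℕ} (hk : k ≤ L)
    (hvk : G.Adj v (f k)) :
    ∃ i j, i ≤ j ∧ j ≤ L ∧ G.Adj v (f i) ∧ G.Adj v (f j) ∧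
      ∀ l ≤ L, G.Adj v (f l) → i ≤ l ∧ l ≤ j := by
  classical
  have hne : ((Finset.range (L + 1)).filter fun l => G.Adj v (f l)).Nonempty :=
    ⟨k, by simp [hvk]; omega⟩
  have hmin := Finset.min'_mem _ hne
  have hmax := Finset.max'_mem _ hne
  simp only [Finset.mem_filter, Finset.mem_range] at hmin hmax
  refine ⟨_, _, Finset.min'_le_max' _ hne, by omega, hmin.2, hmax.2, fun l hl hvl => ?_⟩
  have : l ∈ (Finset.range (L + 1)).filter fun l => G.Adj v (f l) := by simp [hvl]; omega
  exact ⟨Finset.min'_le _ _ this, Finset.le_max' _ _ this⟩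

/-- claim (1) in the proof of Theorem 3.1. -/
theorem statement_4 {V : Type} [Fintype V] (G : SimpleGraph V)
    (hth : ¬ ContainsTheta G) (hpr : ¬ ContainsPrism G)
    {h : V} (H : G.Walk h h) (c : V)
    (hW : IsWheel G H c) (hns : ¬ IsSpecialWheel G H c) (hlen : 7 ≤ H.length)
    {p p' : V} (P : G.Walk p p') (hP : IsSector G H c P)
    (v : V) (hvH : v ∉ H.support) (hvc : v ≠ c)
    (hvT : v ∉ ClosedNbhd G {c} ∪
      (ClosedNbhd G (HoleNbrs G H c) \ {w | w ∈ H.support}))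
    (hdeg : (∃! u : V, u ∈ P.support ∧ G.Adj v u) ∨
      (∃ u w : V, u ∈ P.support ∧ w ∈ P.support ∧ G.Adj v u ∧ G.Adj v w ∧
        u ≠ w ∧ ¬ G.Adj u w))
    (b b' : V)
    (hb : s(p, b) ∈ H.edges) (hbP : b ∉ P.support)
    (hb' : s(p', b') ∈ H.edges) (hb'P : b' ∉ P.support) :
    ∀ u ∈ H.support, G.Adj v u → u ∈ P.support ∨ u = b ∨ u = b' := by
  obtain ⟨hH, hcH, hcard⟩ := hW
  obtain ⟨hPp, hP0, hPH, -, hcp, hcp', hcint⟩ := hP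
  obtain ⟨f, hf, hmemH, hLn, hPf⟩ := hH.exists_indexing hPp hP0 hPH
  set n := H.length
  set L := P.length
  have hf0 : f 0 = p := by rw [← hPf 0 (Nat.zero_le _), Walk.getVert_zero]
  have hfL : f L = p' := by rw [← hPf L le_rfl, Walk.getVert_length]
  have hmemP : ∀ x, x ∈ P.support ↔ ∃ i ≤ L, f i = x := fun x => by
    rw [Walk.mem_support_iff_exists_getVert]
    exact ⟨fun ⟨i, hi, hiL⟩ => ⟨i, hiL, (hPf i hiL).symm.trans hi⟩,
      fun ⟨i, hiL, hi⟩ => ⟨i, (hPf i hiL).trans hi, hiL⟩⟩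
  have hmem : ∀ i < n, f i ∈ H.support := fun i hi => (hmemH _).2 ⟨i, hi, rfl⟩
  have hcf : ∀ i < n, c ≠ f i := fun i hi h => hcH (h ▸ hmem i hi)
  have hvf : ∀ i < n, v ≠ f i := fun i hi h => hvH (h ▸ hmem i hi)
  have hvc' : ¬ G.Adj v c := fun h => hvT (.inl (.inr ⟨c, rfl, h⟩))
  have hvS : ∀ i < n, G.Adj c (f i) → ¬ G.Adj v (f i) := fun i hi hci hvi =>
    hvT (.inr ⟨.inr ⟨f i, ⟨hmem i hi, hci⟩, hvi⟩, hvH⟩)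
  have hcint' : ∀ i, 0 < i → i < L → ¬ G.Adj c (f i) := by
    intro i hi hiL
    refine hcint _ ((hmemP _).2 ⟨i, hiL.le, rfl⟩) ?_ ?_
    · rw [← hf0]
      intro h
      have := hf.inj _ _ (by omega) (by omega) h
      omega
    · rw [← hfL]
      intro h
      have := hf.inj _ _ (by omega) (by omega) h
      omega
  rw [← hf0] at hcp hb
  rw [← hfL] at hcp' hb'
  have hbn : b = f (n - 1) := by
    obtain ⟨i, hi, rfl⟩ := (hmemH b).1 (H.snd_mem_support_of_mem_edges hb)
    have hiL : L < i := not_le.1 fun h => hbP ((hmemP _).2 ⟨i, h, rfl⟩)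
    have := (hf.adj_iff 0 i (by omega) hi).1 (H.adj_of_mem_edges hb)
    congr 1
    omega
  have hbL : b' = f (L + 1) ∧ L + 1 < n := by
    obtain ⟨i, hi, rfl⟩ := (hmemH b').1 (H.snd_mem_support_of_mem_edges hb')
    have hiL : L < i := not_le.1 fun h => hb'P ((hmemP _).2 ⟨i, h, rfl⟩)
    have := (hf.adj_iff L i hiL hi).1 (H.adj_of_mem_edges hb')
    obtain rfl : i = L + 1 := by omega
    exact ⟨rfl, hi⟩
  intro u hu hvu
  by_contra! hcon
  obtain ⟨huP, hub, hub'⟩ := hcon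
  obtain ⟨k, hk, rfl⟩ := (hmemH u).1 hu
  have hkL : L < k := not_le.1 fun h => huP ((hmemP _).2 ⟨k, h, rfl⟩)
  have hkn : k ≠ n - 1 := fun h => hub (by rw [h, hbn])
  have hkL' : k ≠ L + 1 := fun h => hub' (by rw [h, hbL.1])
  -- the attachments of `v` in the sector
  obtain ⟨i, j, hij, hjL, hvi, hvj, hv, hgap⟩ : ∃ i j, i ≤ j ∧ j ≤ L ∧ G.Adj v (f i) ∧
      G.Adj v (f j) ∧ (∀ l ≤ L, G.Adj v (f l) → i ≤ l ∧ l ≤ j) ∧ (i = j ∨ i + 2 ≤ j) := by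
    rcases hdeg with ⟨x, ⟨hx, hvx⟩, huniq⟩ | ⟨x, y, hx, hy, hvx, hvy, hxy, hxy'⟩
    · obtain ⟨a, ha, rfl⟩ := (hmemP x).1 hx
      obtain ⟨i, j, hij, hjL, hvi, hvj, hv⟩ := exists_extreme_neighbors ha hvx
      refine ⟨i, j, hij, hjL, hvi, hvj, hv, .inl (hf.inj i j (by omega) (by omega) ?_)⟩
      exact (huniq _ ⟨(hmemP _).2 ⟨i, by omega, rfl⟩, hvi⟩).trans
        (huniq _ ⟨(hmemP _).2 ⟨j, hjL, rfl⟩, hvj⟩).symm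
    · obtain ⟨a, ha, rfl⟩ := (hmemP x).1 hx
      obtain ⟨a', ha', rfl⟩ := (hmemP y).1 hy
      obtain ⟨i, j, hij, hjL, hvi, hvj, hv⟩ := exists_extreme_neighbors ha hvx
      have h₁ := hv a ha hvx
      have h₂ := hv a' ha' hvy
      have h₃ : a ≠ a' := fun h => hxy (h ▸ rfl)
      have h₄ : a' ≠ a + 1 := by
        rintro rfl
        exact hxy' (hf.adj_succ (by omega))
      have h₅ : a ≠ a' + 1 := by
        rintro rfl
        exact hxy' (hf.adj_succ (by omega)).symm
      exact ⟨i, j, hij, hjL, hvi, hvj, hv, .inr (by omega)⟩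
  have hi0 : 0 < i := Nat.pos_of_ne_zero fun h => hvS 0 (by omega) hcp (h ▸ hvi)
  have hjL' : j < L := lt_of_le_of_ne hjL fun h => hvS L hLn hcp' (h ▸ hvj)
  have hcfar : ∀ m, L + 1 < m → m + 1 < n → ¬ G.Adj c (f m) := fun m hm hm' hcm =>
    hth (hf.containsTheta hcf hvf hvc hvc' hcp hcp' hcint' hi0 hjL' hgap hvi hvj hv
      (by omega) (by omega) hvu hm hm' hcm)
  have hends : ∀ l < n, G.Adj c (f l) → l = 0 ∨ l = L ∨ l = L + 1 ∨ l = n - 1 := by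
    intro l hl hcl
    by_contra! hne
    rcases lt_or_ge l L with h | h
    · exact hcint' l (by omega) h hcl
    · exact hcfar l (by omega) (by omega) hcl
  have hnbrs : ∀ x, x ∈ HoleNbrs G H c ↔ ∃ l < n, G.Adj c (f l) ∧ f l = x := fun x =>
    ⟨fun ⟨hx, hcx⟩ => by
      obtain ⟨l, hl, rfl⟩ := (hmemH x).1 hx
      exact ⟨l, hl, hcx, rfl⟩,
    fun ⟨l, hl, hcl, hlx⟩ => hlx ▸ ⟨hmem l hl, hcl⟩⟩
  have hne : ∀ a a', a < n → a' < n → a ≠ a' → f a ≠ f a' := fun a a' h h' haa' e =>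
    haa' (hf.inj a a' h h' e)
  have hfar : ∀ a a', a + 1 < a' → a' < n → (0 < a ∨ a' + 1 < n) → s(f a, f a') ∉ H.edges :=
    fun a a' h h' h'' e => by
      have := (hf.adj_iff a a' (by omega) h').1 (H.adj_of_mem_edges e)
      omega
  rw [hbn] at hb
  rw [hbL.1] at hb'
  by_cases hcb : G.Adj c (f (n - 1))
  · by_cases hcb' : G.Adj c (f (L + 1))
    · refine hpr (hf.containsPrism (L := L) (by omega) (by omega) hcf fun l hl =>
        ⟨hends l hl, ?_⟩)
      rintro (rfl | rfl | rfl | rfl) <;> assumption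
    · refine hns ⟨⟨hH, hcH, hcard⟩, f 0, f (n - 1), f L, hne _ _ (by omega) (by omega) (by omega),
        hne _ _ (by omega) (by omega) (by omega), hne _ _ (by omega) (by omega) (by omega),
        ?_, hb, hfar _ _ (by omega) (by omega) (by omega),
        Sym2.eq_swap ▸ hfar _ _ (by omega) (by omega) (by omega)⟩
      ext x
      rw [hnbrs]
      constructor
      · rintro ⟨l, hl, hcl, rfl⟩
        rcases hends l hl hcl with rfl | rfl | rfl | rfl
        · simp
        · simp
        · exact absurd hcl hcb'
        · simp
      · rintro (rfl | rfl | rfl)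
        exacts [⟨0, by omega, hcp, rfl⟩, ⟨_, by omega, hcb, rfl⟩, ⟨L, hLn, hcp', rfl⟩]
  · by_cases hcb' : G.Adj c (f (L + 1))
    · refine hns ⟨⟨hH, hcH, hcard⟩, f L, f (L + 1), f 0, hne _ _ (by omega) (by omega) (by omega),
        hne _ _ (by omega) (by omega) (by omega), hne _ _ (by omega) (by omega) (by omega),
        ?_, hb', Sym2.eq_swap ▸ hfar _ _ (by omega) (by omega) (by omega),
        Sym2.eq_swap ▸ hfar _ _ (by omega) (by omega) (by omega)⟩
      ext x
      rw [hnbrs]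
      constructor
      · rintro ⟨l, hl, hcl, rfl⟩
        rcases hends l hl hcl with rfl | rfl | rfl | rfl
        · simp
        · simp
        · simp
        · exact absurd hcl hcb
      · rintro (rfl | rfl | rfl)
        exacts [⟨L, hLn, hcp', rfl⟩, ⟨_, by omega, hcb', rfl⟩, ⟨0, by omega, hcp, rfl⟩]
    · have hsub : HoleNbrs G H c ⊆ {f 0, f L} := fun x hx => by
        obtain ⟨l, hl, hcl, rfl⟩ := (hnbrs x).1 hx
        rcases hends l hl hcl with rfl | rfl | rfl | rfl
        · simp
        · simp
        · exact absurd hcl hcb'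
        · exact absurd hcl hcb
      have := (Set.ncard_le_ncard hsub (Set.toFinite _)).trans (Set.ncard_insert_le _ _)
      rw [Set.ncard_singleton] at this
      omega

end Paper
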